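/- arXiv:2509.14871 — 10 statements merged into one kernel-verified Lean document; each statement's English description precedes it below -/
import Mathlib

section
/- Let u : ℕ → ℤ be defined by u 0 = 0, u 1 = 1, and u (n+2) = u (n+1) − 5·u n for all n. Then u n = 1 if and only if n = 1 or n = 2 or n = 7. -/
theorem lucas_add (u : ℕ → ℤ) (h0 : u 0 = 0) (h1 : u 1 = 1)
    (hrec : ∀ n : ℕ, u (n + 2) = u (n + 1) - 5 * u n) (m n : ℕ) :
    u (m + n) = u m * u (n + 1) + u n * u (m + 1) - u m * u n ∧
      u (m + n + 1) = u (m + 1) * u (n + 1) - 5 * (u m * u n) := by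
  induction m with
  | zero => simp [h0, h1]
  | succ m ih =>
    obtain ⟨ih₁, ih₂⟩ := ih
    have hm := hrec m
    have hmn := hrec (m + n)
    rw [show m + 1 + n = m + n + 1 by ring]
    refine ⟨?_, ?_⟩
    · rw [ih₂, show m + 1 + 1 = m + 2 by rfl, hm]; ring
    · rw [show m + n + 1 + 1 = m + n + 2 by rfl, hmn, ih₁, ih₂,
        show m + 1 + 1 = m + 2 by rfl, hm]
      ring

/-- Modulo `9 * 3 ^ j`, the terms of index `8 * k` and `8 * k + 1` with `3 ^ j ∣ k` are
`0` and `1 + 3 * k`. -/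
theorem lucas_eight_mul (u : ℕ → ℤ) (h0 : u 0 = 0) (h1 : u 1 = 1)
    (hrec : ∀ n : ℕ, u (n + 2) = u (n + 1) - 5 * u n) (j t : ℕ) :
    ∃ y e : ℤ, u (8 * (3 ^ j * t)) = 9 * 3 ^ j * y ∧
      u (8 * (3 ^ j * t) + 1) = 1 + 3 * (3 ^ j * t) + 9 * 3 ^ j * e := by
  have hadd := lucas_add u h0 h1 hrec
  induction j with
  | zero =>
    induction t with
    | zero => exact ⟨0, 0, by simp [h0], by simp [h1]⟩
    | succ t ih =>
      obtain ⟨y, e, hy, he⟩ := ih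
      simp only [pow_zero, one_mul, mul_one] at hy he ⊢
      have h8 : u 8 = -279 := by simp [hrec, h0, h1]
      have h9 : u 9 = -284 := by simp [hrec, h0, h1]
      obtain ⟨ha, hb⟩ := hadd (8 * t) 8
      rw [hy, he, h8, h9] at ha
      rw [hy, he, h8, h9] at hb
      refine ⟨-5 * y - 31 * (1 + 3 * t + 9 * e), -32 - 95 * t - 284 * e + 1395 * y, ?_, ?_⟩
      · rw [show 8 * (t + 1) = 8 * t + 8 by ring, ha]; ring
      · rw [show 8 * (t + 1) = 8 * t + 8 by ring, hb]; push_cast; ring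
  | succ j ih =>
    obtain ⟨y, e, hy, he⟩ := ih
    set N := 8 * (3 ^ j * t) with hN
    obtain ⟨ha, hb⟩ := hadd N N
    obtain ⟨hc, hd⟩ := hadd (N + N) N
    rw [show 8 * (3 ^ (j + 1) * t) = N + N + N by rw [hN]; ring, hc, hd, ha, hb, hy, he, pow_succ]
    generalize (3 : ℤ) ^ j = q
    generalize (t : ℤ) = s
    refine ⟨y * (1 + 3 * (q * s) + 9 * q * e) ^ 2
        - 9 * q * y ^ 2 * (1 + 3 * (q * s) + 9 * q * e) - 108 * q ^ 2 * y ^ 3,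
      e + q * (s + 3 * e) ^ 2 + q ^ 2 * (s + 3 * e) ^ 3
        - 45 * q * y ^ 2 * (1 + 3 * (q * s) + 9 * q * e) + 135 * q ^ 2 * y ^ 3, ?_, ?_⟩ <;> ring

/-- For the sequence `u 0 = 0`, `u 1 = 1`, `u (n+2) = u (n+1) − 5 u n`,
one has `u n = 1` iff `n = 1 ∨ n = 2 ∨ n = 7`. -/
theorem stmt1 (u : ℕ → ℤ) (h0 : u 0 = 0) (h1 : u 1 = 1)
    (hrec : ∀ n : ℕ, u (n + 2) = u (n + 1) - 5 * u n) (n : ℕ) :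
    u n = 1 ↔ n = 1 ∨ n = 2 ∨ n = 7 := by
  constructor
  · intro hn
    obtain ⟨k, a, ha, rfl⟩ : ∃ k a, a < 8 ∧ n = 8 * k + a :=
      ⟨n / 8, n % 8, Nat.mod_lt _ (by norm_num), by omega⟩
    rcases Nat.eq_zero_or_pos k with rfl | hk
    · interval_cases a <;> simp [hrec, h0, h1] at hn ⊢
    obtain ⟨j, t, ht, rfl⟩ := Nat.exists_eq_pow_mul_and_not_dvd hk.ne' 3 (by norm_num)
    obtain ⟨y, e, hy, he⟩ := lucas_eight_mul u h0 h1 hrec j t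
    have ht' : ¬ (3 : ℤ) ∣ t := by exact_mod_cast ht
    have key : ∀ z : ℤ, 3 * (3 ^ j * (t : ℤ)) ≠ 9 * 3 ^ j * z := by
      intro z hz
      refine ht' ⟨z, mul_left_cancel₀ (show (3 * 3 ^ j : ℤ) ≠ 0 by positivity) ?_⟩
      linear_combination hz
    set N := 8 * (3 ^ j * t)
    have hN := hrec N
    have hN1 := hrec (N + 1)
    have hN2 := hrec (N + 2)
    have hN3 := hrec (N + 3)
    have hN4 := hrec (N + 4)
    have hN5 := hrec (N + 5)
    simp only [add_assoc, Nat.reduceAdd] at hN hN1 hN2 hN3 hN4 hN5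
    have hy3 : u N = 3 * (3 * 3 ^ j * y) := by rw [hy]; ring
    have he3 : u (N + 1) = 1 + 3 * (3 ^ j * t + 3 * 3 ^ j * e) := by rw [he]; ring
    interval_cases a
    · simp only [add_zero] at hn; omega
    · exact absurd (show 3 * (3 ^ j * (t : ℤ)) = 9 * 3 ^ j * (-e) by linarith) (key _)
    · exact absurd (show 3 * (3 ^ j * (t : ℤ)) = 9 * 3 ^ j * (5 * y - e) by linarith) (key _)
    · omega
    · omega
    · omega
    · omega
    · exact absurd (show 3 * (3 ^ j * (t : ℤ)) = 9 * 3 ^ j * (280 * y - e) by linarith) (key _)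
  · rintro (rfl | rfl | rfl) <;> simp [hrec, h0, h1]
end

section
/- Let u : ℕ → ℤ be defined by u 0 = 0, u 1 = 1, and u (n+2) = u (n+1) − 5·u n for all n. Then u n ≠ −1 for every natural number n. -/
/-- Modulo 11 the sequence is periodic with period `0, 1, 1, 7, 2`. -/
theorem emod_eleven_cases (u : ℕ → ℤ) (h0 : u 0 = 0) (h1 : u 1 = 1)
    (hrec : ∀ n : ℕ, u (n + 2) = u (n + 1) - 5 * u n) (n : ℕ) :
    (u n % 11 = 0 ∧ u (n + 1) % 11 = 1) ∨ (u n % 11 = 1 ∧ u (n + 1) % 11 = 1) ∨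
    (u n % 11 = 1 ∧ u (n + 1) % 11 = 7) ∨ (u n % 11 = 7 ∧ u (n + 1) % 11 = 2) ∨
    (u n % 11 = 2 ∧ u (n + 1) % 11 = 0) := by
  induction n with
  | zero => simp [h0, h1]
  | succ k ih =>
    have := hrec k
    rw [show k + 1 + 1 = k + 2 from rfl]
    omega

/-- For the sequence `u 0 = 0`, `u 1 = 1`, `u (n+2) = u (n+1) − 5 u n`,
one has `u n ≠ −1` for all `n`. -/
theorem stmt2 (u : ℕ → ℤ) (h0 : u 0 = 0) (h1 : u 1 = 1)
    (hrec : ∀ n : ℕ, u (n + 2) = u (n + 1) - 5 * u n) (n : ℕ) :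
    u n ≠ -1 := by
  have := emod_eleven_cases u h0 h1 hrec n
  omega
end

section
/- For positive natural numbers x and n, the equation x² + 19 = 4·5^n holds if and only if (x, n) = (1, 1) or (x, n) = (9, 2) or (x, n) = (559, 7). -/
theorem three_pow_dvd_pow_sub_pow_of_nine_dvd_sub {R : Type*} [CommRing R] {a b : R}
    (h : (9 : R) ∣ a - b)
    (t m : ℕ) : (3 : R) ^ (t + 2) ∣ a ^ (3 ^ t * m) - b ^ (3 ^ t * m) := by
  have key : (3 : R) ^ (t + 2) ∣ a ^ 3 ^ t - b ^ 3 ^ t := by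
    induction t with
    | zero => norm_num; exact h
    | succ t ih =>
      obtain ⟨c, hc⟩ := ih
      have ha : a ^ 3 ^ t = b ^ 3 ^ t + 3 ^ (t + 2) * c := by rw [← hc]; ring
      refine ⟨(b ^ 3 ^ t) ^ 2 * c + b ^ 3 ^ t * 3 ^ (t + 2) * c ^ 2
        + 3 ^ (2 * t + 3) * c ^ 3, ?_⟩
      rw [pow_succ 3 t, pow_mul, pow_mul, ha]
      ring
  rw [pow_mul, pow_mul]
  exact key.trans (sub_dvd_pow_sub_pow _ _ m)

theorem three_pow_dvd_of_dvd_four_pow_sub_one {q t : ℕ}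
    (h : (3 : ℤ) ^ (t + 1) ∣ 4 ^ q - 1) : 3 ^ t ∣ q := by
  have hv := Int.emultiplicity_pow_sub_pow (p := 3) Nat.prime_three (by decide) (x := 4) (y := 1)
    (by norm_num) (by norm_num) q
  have h1 : emultiplicity (3 : ℤ) (4 - 1) = 1 := by
    norm_num
    exact (FiniteMultiplicity.of_prime_left Int.prime_three (by norm_num)).emultiplicity_self
  rw [one_pow, show ((3 : ℕ) : ℤ) = 3 from rfl, h1] at hv
  have h2 := le_emultiplicity_of_pow_dvd h
  rw [hv] at h2
  apply pow_dvd_of_le_emultiplicity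
  push_cast at h2
  rw [add_comm] at h2
  exact (ENat.add_le_add_iff_left (by simp)).1 h2

open QuadraticAlgebra in
/-- With `ω ^ 2 = ω - 5`, the sequence of `ω`-coordinates of the powers of `ω` satisfies a
`3`-adic congruence along each residue class mod `8`, because `ω ^ 8 ≡ 4` mod `9`. -/
theorem im_omega_pow_add_eight_mul_sub (r t m : ℕ) :
    (3 : ℤ) ^ (t + 2) ∣ ((ω : QuadraticAlgebra ℤ (-5) 1) ^ (r + 8 * (3 ^ t * m))).im
      - 4 ^ (3 ^ t * m) * ((ω : QuadraticAlgebra ℤ (-5) 1) ^ r).im := by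
  have h : (9 : QuadraticAlgebra ℤ (-5) 1) ∣ ω ^ 8 - 4 := by
    refine ⟨⟨-1, -31⟩, ?_⟩
    ext <;> simp [pow_succ]
  obtain ⟨c, hc⟩ := three_pow_dvd_pow_sub_pow_of_nine_dvd_sub h t m
  refine ⟨((ω : QuadraticAlgebra ℤ (-5) 1) ^ r * c).im, ?_⟩
  have h2 : (ω : QuadraticAlgebra ℤ (-5) 1) ^ (r + 8 * (3 ^ t * m))
      - ((4 ^ (3 ^ t * m) : ℤ) : QuadraticAlgebra ℤ (-5) 1) * ω ^ r
      = ((3 ^ (t + 2) : ℤ) : QuadraticAlgebra ℤ (-5) 1) * (ω ^ r * c) := by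
    push_cast
    rw [pow_add, pow_mul]
    linear_combination ω ^ r * hc
  have h3 := congrArg QuadraticAlgebra.im h2
  simp only [im_sub, im_mul, im_intCast, re_intCast, zero_mul, mul_zero, add_zero,
    Int.cast_id] at h3
  rw [im_mul]
  linarith

open QuadraticAlgebra in
theorem eq_of_im_omega_pow_eq_one {n : ℕ}
    (h : ((ω : QuadraticAlgebra ℤ (-5) 1) ^ n).im = 1) : n = 1 ∨ n = 2 ∨ n = 7 := by
  obtain ⟨r, q, hr, rfl⟩ : ∃ r q, r < 8 ∧ n = r + 8 * q :=
    ⟨n % 8, n / 8, Nat.mod_lt _ (by norm_num), (Nat.mod_add_div n 8).symm⟩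
  have hmod : (3 : ℤ) ∣ 1 - ((ω : QuadraticAlgebra ℤ (-5) 1) ^ r).im := by
    have h0 := im_omega_pow_add_eight_mul_sub r 0 q
    simp only [pow_zero, one_mul, h] at h0
    have h1 : (3 : ℤ) ∣ 4 ^ q - 1 := by
      simpa using sub_dvd_pow_sub_pow (4 : ℤ) 1 q
    have h2 := (Dvd.intro_left _ (by norm_num : (3 : ℤ) * 3 = 3 ^ (0 + 2))).trans h0
    have h3 := dvd_add h2 (h1.mul_right ((ω : QuadraticAlgebra ℤ (-5) 1) ^ r).im)
    rwa [show ∀ u v : ℤ, 1 - v * u + (v - 1) * u = 1 - u by intros; ring] at h3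
  have hr' : ((ω : QuadraticAlgebra ℤ (-5) 1) ^ r).im = 1 ∧ (r = 1 ∨ r = 2 ∨ r = 7) := by
    interval_cases r <;> simp [pow_succ] at hmod ⊢
  have hq : ∀ t, 3 ^ t ∣ q := by
    intro t
    induction t with
    | zero => simp
    | succ t ih =>
      obtain ⟨m, rfl⟩ := ih
      have h0 := im_omega_pow_add_eight_mul_sub r t m
      rw [h, hr'.1, mul_one, dvd_sub_comm] at h0
      exact three_pow_dvd_of_dvd_four_pow_sub_one h0
  have hq0 : q = 0 := by
    by_contra hne
    exact absurd (Nat.le_of_dvd (Nat.pos_of_ne_zero hne) (hq q))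
      (not_le.2 (Nat.lt_pow_self (by norm_num)))
  subst hq0
  simpa using hr'.2

open QuadraticAlgebra in
/-- Unique factorization for elements of norm `5 ^ n` not divisible by the conjugate of `ω`. -/
theorem eq_omega_pow_or_neg_of_norm_eq (n : ℕ) (a b : ℤ) (h : a ^ 2 + a * b + 5 * b ^ 2 = 5 ^ n)
    (hab : ¬ 5 ∣ a + b) :
    (⟨a, b⟩ : QuadraticAlgebra ℤ (-5) 1) = ω ^ n ∨
      (⟨a, b⟩ : QuadraticAlgebra ℤ (-5) 1) = -ω ^ n := by
  induction n generalizing a b with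
  | zero =>
    have hb : b = 0 := by nlinarith [sq_nonneg (2 * a + b)]
    subst hb
    have : a = 1 ∨ a = -1 := by simpa using h
    rcases this with rfl | rfl
    · left; ext <;> simp
    · right; ext <;> simp
  | succ n ih =>
    have h5 : Prime (5 : ℤ) := by norm_num
    have ha : (5 : ℤ) ∣ a * (a + b) := ⟨5 ^ n - b ^ 2, by rw [pow_succ 5 n] at h; linarith⟩
    obtain ⟨c, rfl⟩ := (h5.dvd_or_dvd ha).resolve_right hab
    have hω : (⟨5 * c, b⟩ : QuadraticAlgebra ℤ (-5) 1) = ω * ⟨b + c, -c⟩ := by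
      ext <;> simp
    rcases ih (b + c) (-c) (by rw [pow_succ 5 n] at h; linarith) (by omega) with h1 | h1
    · left; rw [hω, h1, pow_succ']
    · right; rw [hω, h1, pow_succ']; ring

open QuadraticAlgebra in
theorem eq_of_sq_add_self_add_five_eq_of_not_dvd {n : ℕ} (hn : 0 < n) {a : ℤ}
    (h : a ^ 2 + a + 5 = 5 ^ n) (ha : ¬ 5 ∣ a + 1) : n = 1 ∨ n = 2 ∨ n = 7 := by
  have hU : ∀ k : ℕ, (5 : ℤ) ∣ ((ω : QuadraticAlgebra ℤ (-5) 1) ^ (k + 1)).re ∧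
      (5 : ℤ) ∣ ((ω : QuadraticAlgebra ℤ (-5) 1) ^ (k + 1)).im - 1 := by
    intro k
    induction k with
    | zero => simp
    | succ k ih =>
      rw [pow_succ _ (k + 1)]
      simp only [re_mul, im_mul, omega_re, omega_im]
      omega
  obtain ⟨k, rfl⟩ : ∃ k, n = k + 1 := ⟨n - 1, by omega⟩
  rcases eq_omega_pow_or_neg_of_norm_eq _ a 1 (by linarith) ha with h1 | h1
  · exact eq_of_im_omega_pow_eq_one (congrArg QuadraticAlgebra.im h1).symm
  · have h2 := congrArg QuadraticAlgebra.im h1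
    have h3 := (hU k).2
    simp only [im_neg] at h2
    omega

theorem eq_of_sq_add_self_add_five_eq {n : ℕ} (hn : 0 < n) {a : ℤ}
    (h : a ^ 2 + a + 5 = 5 ^ n) : n = 1 ∨ n = 2 ∨ n = 7 := by
  by_cases ha : (5 : ℤ) ∣ a + 1
  · exact eq_of_sq_add_self_add_five_eq_of_not_dvd hn (a := -a - 1) (by linarith) (by omega)
  · exact eq_of_sq_add_self_add_five_eq_of_not_dvd hn h ha

/-- For positive naturals `x`, `n`, `x² + 19 = 4·5^n` iff
`(x, n) ∈ {(1,1), (9,2), (559,7)}`. -/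
theorem stmt5 (x n : ℕ) (hx : 0 < x) (hn : 0 < n) :
    x ^ 2 + 19 = 4 * 5 ^ n ↔
      (x = 1 ∧ n = 1) ∨ (x = 9 ∧ n = 2) ∨ (x = 559 ∧ n = 7) := by
  constructor
  · intro h
    have hodd : x % 2 = 1 := by
      rcases Nat.mod_two_eq_zero_or_one x with h0 | h0
      · obtain ⟨y, rfl⟩ := Nat.dvd_of_mod_eq_zero h0
        ring_nf at h
        omega
      · exact h0
    obtain ⟨y, rfl⟩ : ∃ y, x = 2 * y + 1 := ⟨x / 2, by omega⟩
    have hy : (y : ℤ) ^ 2 + y + 5 = 5 ^ n := by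
      zify at h
      linarith
    rcases eq_of_sq_add_self_add_five_eq hn hy with rfl | rfl | rfl
    · left; exact ⟨by nlinarith, rfl⟩
    · right; left; exact ⟨by nlinarith, rfl⟩
    · right; right; exact ⟨by nlinarith, rfl⟩
  · rintro (⟨rfl, rfl⟩ | ⟨rfl, rfl⟩ | ⟨rfl, rfl⟩) <;> norm_num
end

section
/- For every natural number r ≥ 1, the equality (Nat.sqrt (4·5^r))^2 + 19 = 4·5^r holds if and only if r = 7. In other words, the only power q = 5^r of 5 whose discriminant d(F_q) := ⌊2√q⌋² − 4q equals −19 is q = 5^7 = 78125 (with ⌊2√(5^7)⌋ = 559). -/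
open QuadraticAlgebra

/-- The order `ℤ[(1 + √-19) / 2]`, generated by an element `ω` with `ω² = ω - 5`. -/
abbrev OrderNegNineteen : Type := QuadraticAlgebra ℤ (-5) 1

theorem exists_pow_three_pow_mul_eq {R : Type*} [CommRing R] {x z : R} (hx : x = 1 + 3 + 9 * z)
    (l t : ℕ) : ∃ w : R, x ^ (3 ^ l * t) = 1 + t * 3 ^ (l + 1) + 3 ^ (l + 2) * w := by
  have key : ∃ w : R, x ^ 3 ^ l = 1 + 3 ^ (l + 1) + 3 ^ (l + 2) * w := by
    induction l with
    | zero => exact ⟨z, by rw [hx]; ring⟩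
    | succ l ih =>
      obtain ⟨w, hw⟩ := ih
      refine ⟨w + 3 ^ l * (1 + 3 * w) ^ 2 + 3 ^ l * 3 ^ l * (1 + 3 * w) ^ 3, ?_⟩
      rw [pow_succ 3 l, pow_mul, hw]
      ring
  obtain ⟨w, hw⟩ := key
  rw [pow_mul, hw]
  induction t with
  | zero => exact ⟨0, by simp⟩
  | succ t ih =>
    obtain ⟨v, hv⟩ := ih
    refine ⟨v + w + 3 ^ (l + 1) * v + 3 ^ l * t * (1 + 3 * w) + 3 ^ (l + 2) * v * w, ?_⟩
    rw [pow_succ, hv]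
    push_cast
    ring

theorem omega_pow_eight : (omega : OrderNegNineteen) ^ 8 = 1 + 3 + 9 * ⟨-1, -31⟩ := by
  decide +kernel

theorem exists_im_omega_pow_eq (s l t : ℕ) : ∃ c : ℤ, ((omega : OrderNegNineteen) ^
    (s + 8 * (3 ^ l * t))).im =
      (1 + t * 3 ^ (l + 1)) * ((omega : OrderNegNineteen) ^ s).im + 3 ^ (l + 2) * c := by
  obtain ⟨w, hw⟩ := exists_pow_three_pow_mul_eq omega_pow_eight l t
  refine ⟨(w * omega ^ s).im, ?_⟩
  have h : (omega : OrderNegNineteen) ^ (s + 8 * (3 ^ l * t)) =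
      ((1 + t * 3 ^ (l + 1) : ℤ) : OrderNegNineteen) * omega ^ s +
        ((3 ^ (l + 2) : ℤ) : OrderNegNineteen) * (w * omega ^ s) := by
    rw [pow_add, pow_mul, hw]
    push_cast
    ring
  rw [h]
  generalize w * omega ^ s = v
  generalize (omega : OrderNegNineteen) ^ s = u
  simp only [im_add, im_mul, re_intCast, im_intCast, Int.cast_id]
  ring

theorem im_omega_pow_succ_modEq (n : ℕ) :
    ((omega : OrderNegNineteen) ^ (n + 1)).im ≡ 1 [ZMOD 5] := by
  induction n with
  | zero => simp
  | succ n ih =>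
    have h (n : ℕ) : ((omega : OrderNegNineteen) ^ (n + 1)).re =
        -5 * ((omega : OrderNegNineteen) ^ n).im := by
      rw [pow_succ, re_mul]; simp
    rw [pow_succ, im_mul, h]
    simp only [omega_re, omega_im]
    rw [Int.modEq_iff_dvd] at ih ⊢
    omega

theorem eq_of_im_omega_pow_eq_one_s6 {s r : ℕ} (hsr : s ≤ r) (hmod : r ≡ s [MOD 8])
    (hs : ((omega : OrderNegNineteen) ^ s).im = 1) (hr : ((omega : OrderNegNineteen) ^ r).im = 1) :
    r = s := by
  obtain ⟨d, rfl⟩ := Nat.exists_eq_add_of_le hsr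
  obtain ⟨k, rfl⟩ : 8 ∣ d := by
    have := (Nat.modEq_iff_dvd' hsr).1 hmod.symm
    simpa using this
  have hdvd (l : ℕ) : 3 ^ l ∣ k := by
    induction l with
    | zero => simp
    | succ l ih =>
      obtain ⟨t, rfl⟩ := ih
      obtain ⟨c, hc⟩ := exists_im_omega_pow_eq s l t
      rw [hr, hs] at hc
      have h3 : (3 : ℤ) ^ (l + 1) * (t + 3 * c) = 0 := by linear_combination -hc
      have h0 : (t : ℤ) + 3 * c = 0 := by simpa using h3
      rw [pow_succ]
      exact mul_dvd_mul_left _ (by omega)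
  have hk : k = 0 := by
    by_contra h
    exact absurd (Nat.le_of_dvd (Nat.pos_of_ne_zero h) (hdvd k))
      (not_le.2 (Nat.lt_pow_self (by norm_num)))
  simp [hk]

theorem eq_one_or_eq_seven_of_im_omega_pow {r : ℕ} (hodd : Odd r)
    (h : ((omega : OrderNegNineteen) ^ r).im = 1 ∨ ((omega : OrderNegNineteen) ^ r).im = -1) :
    r = 1 ∨ r = 7 := by
  have hr : ((omega : OrderNegNineteen) ^ r).im = 1 := by
    obtain ⟨k, rfl⟩ := hodd
    have := im_omega_pow_succ_modEq (2 * k)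
    rw [Int.modEq_iff_dvd] at this
    omega
  obtain ⟨c, hc⟩ := exists_im_omega_pow_eq (r % 8) 0 (r / 8)
  rw [pow_zero, one_mul, Nat.mod_add_div, hr] at hc
  have h1 : ((omega : OrderNegNineteen) ^ 1).im = 1 := by decide +kernel
  have h3 : ((omega : OrderNegNineteen) ^ 3).im = -4 := by decide +kernel
  have h5 : ((omega : OrderNegNineteen) ^ 5).im = 11 := by decide +kernel
  have h7 : ((omega : OrderNegNineteen) ^ 7).im = 1 := by decide +kernel
  have hcases : r % 8 = 1 ∨ r % 8 = 3 ∨ r % 8 = 5 ∨ r % 8 = 7 := by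
    rw [Nat.odd_iff] at hodd; omega
  rcases hcases with h8 | h8 | h8 | h8 <;> rw [h8] at hc
  · exact .inl (eq_of_im_omega_pow_eq_one_s6 (by omega) h8 h1 hr)
  · rw [h3] at hc; omega
  · rw [h5] at hc; omega
  · exact .inr (eq_of_im_omega_pow_eq_one_s6 (by omega) h8 h7 hr)

/-- An element of norm `5 ^ r` not divisible by the conjugate of `ω` is, up to sign, `ω ^ r`. -/
theorem eq_or_eq_neg_omega_pow_of_norm_eq (r : ℕ) (a b : ℤ)
    (hnorm : a ^ 2 + a * b + 5 * b ^ 2 = 5 ^ r) (hab : ¬ 5 ∣ a + b) :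
    (⟨a, b⟩ : OrderNegNineteen) = omega ^ r ∨ (⟨a, b⟩ : OrderNegNineteen) = -omega ^ r := by
  induction r generalizing a b with
  | zero =>
    have hb : b = 0 := by
      by_contra h
      have : 0 < b ^ 2 := by positivity
      nlinarith [sq_nonneg (2 * a + b)]
    subst hb
    have ha : a = 1 ∨ a = -1 := by simpa using hnorm
    rcases ha with rfl | rfl
    · exact .inl (by decide +kernel)
    · exact .inr (by decide +kernel)
  | succ r ih =>
    have hprod : (5 : ℤ) ∣ a * (a + b) :=
      ⟨5 ^ r - b ^ 2, by linear_combination hnorm⟩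
    have ha : (5 : ℤ) ∣ a := (Int.Prime.dvd_mul' Nat.prime_five hprod).resolve_right hab
    obtain ⟨e, rfl⟩ := ha
    have hz : (⟨5 * e, b⟩ : OrderNegNineteen) = ⟨b + e, -e⟩ * omega := by
      ext <;> simp
    have hnorm' : (b + e) ^ 2 + (b + e) * (-e) + 5 * (-e) ^ 2 = 5 ^ r := by
      rw [pow_succ 5 r] at hnorm
      linarith
    rw [hz, pow_succ, ← neg_mul]
    rcases ih (b + e) (-e) hnorm' (by omega) with h | h
    · exact .inl (by rw [h])
    · exact .inr (by rw [h])

theorem odd_of_sqrt_sq_add_nineteen {r : ℕ}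
    (h : (Nat.sqrt (4 * 5 ^ r)) ^ 2 + 19 = 4 * 5 ^ r) : Odd r := by
  rw [← Nat.not_even_iff_odd]
  rintro ⟨k, rfl⟩
  have hsq : 4 * 5 ^ (k + k) = (2 * 5 ^ k) * (2 * 5 ^ k) := by rw [pow_add]; ring
  rw [hsq, Nat.sqrt_eq] at h
  linarith

/-- For `r ≥ 1`, the discriminant of `𝔽_{5^r}` equals `−19`
(i.e. `⌊2√(5^r)⌋² + 19 = 4·5^r`) iff `r = 7`. -/
theorem stmt6 (r : ℕ) (hr : 1 ≤ r) :
    (Nat.sqrt (4 * 5 ^ r)) ^ 2 + 19 = 4 * 5 ^ r ↔ r = 7 := by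
  constructor
  · intro h
    have hodd := odd_of_sqrt_sq_add_nineteen h
    have hr1 : r ≠ 1 := by
      rintro rfl
      exact absurd h (by decide +kernel)
    refine (eq_one_or_eq_seven_of_im_omega_pow hodd ?_).resolve_left hr1
    generalize Nat.sqrt (4 * 5 ^ r) = x at h
    obtain ⟨m, rfl⟩ : Odd x := by
      by_contra hx
      obtain ⟨m, rfl⟩ := Nat.not_odd_iff_even.1 hx
      have : (m + m) ^ 2 = 4 * m ^ 2 := by ring
      omega
    have hm : (m : ℤ) ^ 2 + m + 5 = 5 ^ r := by
      zify at h
      linarith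
    by_cases h5 : (5 : ℤ) ∣ m + 1
    · rcases eq_or_eq_neg_omega_pow_of_norm_eq r (m + 1) (-1) (by linarith) (by omega)
        with h | h
      · exact .inr (congrArg im h).symm
      · exact .inl (by have := congrArg im h; rw [im_neg] at this; linarith)
    · rcases eq_or_eq_neg_omega_pow_of_norm_eq r m 1 (by linarith) h5 with h | h
      · exact .inl (congrArg im h).symm
      · exact .inr (by have := congrArg im h; rw [im_neg] at this; linarith)
  · rintro rfl
    decide +kernel
end

section
/- For an integer y and a natural number n ≥ 1, the equation y² − y + 5 = 5^n holds if and only if (y, n) is one of (0, 1), (1, 1), (5, 2), (−4, 2), (280, 7), (−279, 7). -/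
/-- The ring of integers of `ℚ(√-19)`, presented as `ℤ[ω]` with `ω² = ω - 5`. -/
abbrev IntSqrtNeg19 : Type := QuadraticAlgebra ℤ (-5) 1

namespace IntSqrtNeg19

open scoped QuadraticAlgebra

/-- The generator `ω = (1 + √-19) / 2`, of norm `5`. -/
def gen : IntSqrtNeg19 := ⟨0, 1⟩

theorem re_gen_mul (z : IntSqrtNeg19) : (gen * z).re = -5 * z.im := by
  simp [gen]

theorem im_gen_mul (z : IntSqrtNeg19) : (gen * z).im = z.re + z.im := by
  simp [gen]

/-- An element of norm `5 ^ n` not divisible by the conjugate of `ω` is `± ω ^ n`. -/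
theorem eq_or_eq_neg_gen_pow (n : ℕ) (a b : ℤ) (h : a ^ 2 + a * b + 5 * b ^ 2 = 5 ^ n)
    (h5 : ¬ (5 : ℤ) ∣ a + b) :
    (⟨a, b⟩ : IntSqrtNeg19) = gen ^ n ∨ (⟨a, b⟩ : IntSqrtNeg19) = -gen ^ n := by
  induction n generalizing a b with
  | zero =>
    have hb : b = 0 := by
      have : b ^ 2 < 1 := by nlinarith [sq_nonneg (2 * a + b)]
      exact sq_eq_zero_iff.mp (le_antisymm (by omega) (sq_nonneg b))
    subst hb
    have ha : a ^ 2 = 1 := by simpa using h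
    rcases eq_or_eq_neg_of_sq_eq_sq a 1 (by simpa using ha) with rfl | rfl
    · left; ext <;> simp
    · right; ext <;> simp
  | succ n ih =>
    have hdvd : (5 : ℤ) ∣ a * (a + b) := ⟨5 ^ n - b ^ 2, by linear_combination h⟩
    obtain ⟨c, rfl⟩ :=
      ((Int.prime_iff_natAbs_prime.mpr (by norm_num)).dvd_or_dvd hdvd).resolve_right h5
    have key : (⟨5 * c, b⟩ : IntSqrtNeg19) = gen * ⟨b + c, -c⟩ := by
      ext
      · rw [re_gen_mul]; ring
      · rw [im_gen_mul]; ring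
    have hn : (b + c) ^ 2 + (b + c) * (-c) + 5 * (-c) ^ 2 = 5 ^ n := by
      linarith [pow_succ (5 : ℤ) n]
    rw [key, pow_succ']
    rcases ih (b + c) (-c) hn (by omega) with h' | h' <;> rw [h']
    · exact Or.inl rfl
    · exact Or.inr (mul_neg _ _)

theorem im_gen_pow_emod_five (n : ℕ) :
    (gen ^ (n + 1)).re % 5 = 0 ∧ (gen ^ (n + 1)).im % 5 = 1 := by
  induction n with
  | zero => simp [gen]
  | succ n ih =>
    rw [pow_succ', re_gen_mul, im_gen_mul]
    omega

theorem im_intCast_mul (m : ℤ) (z : IntSqrtNeg19) : ((m : IntSqrtNeg19) * z).im = m * z.im := by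
  simp

/-- `ω ^ (8 * 3 ^ s) ≡ 1 + 3 ^ (s + 1)` modulo `3 ^ (s + 2)`. -/
theorem gen_pow_eight_mul_three_pow (s : ℕ) :
    ∃ β : IntSqrtNeg19, gen ^ (8 * 3 ^ s) = 1 + 3 ^ (s + 1) * (1 + 3 * β) := by
  induction s with
  | zero =>
    refine ⟨⟨-1, -31⟩, ?_⟩
    ext <;> simp [gen, pow_succ]
  | succ s ih =>
    obtain ⟨β, hβ⟩ := ih
    refine ⟨β + 3 ^ s * (1 + 3 * β) ^ 2 + 3 ^ (2 * s) * (1 + 3 * β) ^ 3, ?_⟩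
    rw [pow_succ, ← mul_assoc, pow_mul, hβ]
    ring

/-- `(1 + x) ^ k` modulo `y`, when `x ^ 2` is divisible by `y`. -/
theorem exists_one_add_pow_eq {R : Type*} [CommRing R] {x y : R} (h : y ∣ x ^ 2) (k : ℕ) :
    ∃ δ : R, (1 + x) ^ k = 1 + k * x + y * δ := by
  obtain ⟨c, hc⟩ := h
  induction k with
  | zero => exact ⟨0, by simp⟩
  | succ k ih =>
    obtain ⟨δ, hδ⟩ := ih
    refine ⟨δ * (1 + x) + k * c, ?_⟩
    rw [pow_succ, hδ]
    push_cast
    linear_combination (k : R) * hc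

/-- First-order expansion of the coefficient of `ω` along the progression `m + 8 * 3 ^ s * k`. -/
theorem exists_im_gen_pow_add (m s k : ℕ) :
    ∃ d : ℤ, (gen ^ (m + 8 * 3 ^ s * k)).im =
      (1 + k * 3 ^ (s + 1)) * (gen ^ m).im + 3 ^ (s + 2) * d := by
  obtain ⟨β, hβ⟩ := gen_pow_eight_mul_three_pow s
  obtain ⟨δ, hδ⟩ := exists_one_add_pow_eq (x := 3 ^ (s + 1) * (1 + 3 * β)) (y := 3 ^ (s + 2))
    ⟨3 ^ s * (1 + 3 * β) ^ 2, by ring⟩ k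
  refine ⟨(gen ^ m * (k * β + δ)).im, ?_⟩
  have key : gen ^ (m + 8 * 3 ^ s * k) =
      ((1 + k * 3 ^ (s + 1) : ℤ) : IntSqrtNeg19) * gen ^ m +
        ((3 ^ (s + 2) : ℤ) : IntSqrtNeg19) * (gen ^ m * (k * β + δ)) := by
    rw [pow_add, pow_mul, hβ, hδ]
    push_cast
    ring
  rw [key, QuadraticAlgebra.im_add, im_intCast_mul, im_intCast_mul]

/-- The coefficient of `ω` takes the value `1` at most once in each class modulo `8`. -/
theorem eq_zero_of_im_gen_pow_add_eq_one {m t : ℕ} (hm : (gen ^ m).im = 1)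
    (ht : (gen ^ (m + 8 * t)).im = 1) : t = 0 := by
  have hdvd (s : ℕ) : 3 ^ s ∣ t := by
    induction s with
    | zero => simp
    | succ s ih =>
      obtain ⟨k, rfl⟩ := ih
      obtain ⟨d, hd⟩ := exists_im_gen_pow_add m s k
      rw [mul_assoc, ht, hm] at hd
      have h3 : (3 : ℤ) ^ (s + 1) * (k + 3 * d) = 0 := by linear_combination -hd
      have hk : (k : ℤ) + 3 * d = 0 := (mul_eq_zero.mp h3).resolve_left (by positivity)
      rw [pow_succ]
      exact Nat.mul_dvd_mul_left _ (by omega)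
  by_contra h0
  exact (Nat.lt_pow_self (by norm_num : 1 < 3)).not_ge
    (Nat.le_of_dvd (Nat.pos_of_ne_zero h0) (hdvd t))

theorem eq_one_or_two_or_seven_of_im_gen_pow_eq_one {n : ℕ} (h : (gen ^ n).im = 1) :
    n = 1 ∨ n = 2 ∨ n = 7 := by
  obtain ⟨r, t, hr, rfl⟩ : ∃ r t, r < 8 ∧ n = r + 8 * t :=
    ⟨n % 8, n / 8, Nat.mod_lt _ (by norm_num), (Nat.mod_add_div n 8).symm⟩
  obtain ⟨d, hd⟩ := exists_im_gen_pow_add r 0 t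
  have hmod : (gen ^ r).im % 3 = 1 := by
    rw [pow_zero, mul_one, h] at hd
    have : (gen ^ r).im = 1 - 3 * (t * (gen ^ r).im + 3 * d) := by linear_combination -hd
    omega
  have hcases : r = 1 ∨ r = 2 ∨ r = 7 := by
    clear h hd
    interval_cases r <;> simp_all [gen, pow_succ]
  have hone : (gen ^ r).im = 1 := by
    rcases hcases with rfl | rfl | rfl <;> simp [gen, pow_succ]
  have := eq_zero_of_im_gen_pow_add_eq_one hone h
  omega

end IntSqrtNeg19

open IntSqrtNeg19 in
theorem exponent_of_sq_sub_self_add_five_of_not_dvd {y : ℤ} {n : ℕ} (hn : 1 ≤ n)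
    (h : y ^ 2 - y + 5 = 5 ^ n) (h5 : ¬ (5 : ℤ) ∣ 1 - y) : n = 1 ∨ n = 2 ∨ n = 7 := by
  rcases eq_or_eq_neg_gen_pow n (-y) 1 (by linarith) (by omega) with hz | hz
  · exact eq_one_or_two_or_seven_of_im_gen_pow_eq_one (congrArg QuadraticAlgebra.im hz).symm
  · have him : 1 = -(gen ^ n).im := by
      simpa only [QuadraticAlgebra.im_neg] using congrArg QuadraticAlgebra.im hz
    obtain ⟨k, rfl⟩ := Nat.exists_eq_add_of_le' hn
    have := (im_gen_pow_emod_five k).2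
    omega

theorem exponent_of_sq_sub_self_add_five {y : ℤ} {n : ℕ} (hn : 1 ≤ n)
    (h : y ^ 2 - y + 5 = 5 ^ n) : n = 1 ∨ n = 2 ∨ n = 7 := by
  by_cases h5 : (5 : ℤ) ∣ 1 - y
  · exact exponent_of_sq_sub_self_add_five_of_not_dvd (y := 1 - y) hn (by linarith) (by omega)
  · exact exponent_of_sq_sub_self_add_five_of_not_dvd hn h h5


/-- For an integer `y` and `n ≥ 1`, `y² − y + 5 = 5^n` iff
`(y, n) ∈ {(0,1), (1,1), (5,2), (−4,2), (280,7), (−279,7)}`. -/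
theorem stmt7 (y : ℤ) (n : ℕ) (hn : 1 ≤ n) :
    y ^ 2 - y + 5 = 5 ^ n ↔
      (y = 0 ∧ n = 1) ∨ (y = 1 ∧ n = 1) ∨ (y = 5 ∧ n = 2) ∨
      (y = -4 ∧ n = 2) ∨ (y = 280 ∧ n = 7) ∨ (y = -279 ∧ n = 7) := by
  constructor
  · intro h
    rcases exponent_of_sq_sub_self_add_five hn h with rfl | rfl | rfl
    · have : y * (y - 1) = 0 := by linarith
      rcases mul_eq_zero.mp this with h | h <;> omega
    · have : (y - 5) * (y + 4) = 0 := by linarith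
      rcases mul_eq_zero.mp this with h | h <;> omega
    · have : (y - 280) * (y + 279) = 0 := by linarith
      rcases mul_eq_zero.mp this with h | h <;> omega
  · rintro (⟨rfl, rfl⟩ | ⟨rfl, rfl⟩ | ⟨rfl, rfl⟩ | ⟨rfl, rfl⟩ | ⟨rfl, rfl⟩ | ⟨rfl, rfl⟩) <;> norm_num
end

section
/- Let F be a finite field whose cardinality is congruent to 2 or 3 modulo 5. If M is an invertible 3×3 matrix over F such that M^5 is a scalar matrix (M^5 = c • 1 for some c ∈ F), then M itself is a scalar matrix (M = d • 1 for some d ∈ F). Equivalently, the projective general linear group PGL₃(F) has no element of order 5. -/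
/-- If `#F ≡ 2` or `3 (mod 5)`, then `5` does not divide the order of `GL₃(F)`. -/
theorem coprime_natCard_GL_three_five (F : Type*) [Field F] [Fintype F]
    (hF : Fintype.card F % 5 = 2 ∨ Fintype.card F % 5 = 3) :
    (Nat.card (Matrix.GeneralLinearGroup (Fin 3) F)).Coprime 5 := by
  rw [Nat.coprime_comm, Nat.Prime.coprime_iff_not_dvd Nat.prime_five, Matrix.card_GL_field,
    Fin.prod_univ_three, Nat.prime_five.dvd_mul, Nat.prime_five.dvd_mul]
  obtain ⟨q, hq⟩ : ∃ q, Fintype.card F = q := ⟨_, rfl⟩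
  rw [hq] at hF ⊢
  have hpos : 0 < q := by omega
  have key : ∀ i : ℕ, i < 3 → ¬ 5 ∣ q ^ 3 - q ^ i := by
    intro i hi hdvd
    have hmod : q ^ i % 5 = q ^ 3 % 5 :=
      (Nat.modEq_iff_dvd' (Nat.pow_le_pow_right hpos hi.le)).2 hdvd
    rw [Nat.pow_mod, Nat.pow_mod q 3] at hmod
    rcases hF with h | h <;> rw [h] at hmod <;> interval_cases i <;> omega
  rintro ((h | h) | h) <;> exact key _ (by decide) h

/-- Over a finite field `F` with `#F ≡ 2` or `3 (mod 5)`, any invertible `3×3`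
matrix whose fifth power is scalar is itself scalar; equivalently
`PGL₃(F)` has no element of order `5`. -/
theorem stmt9 (F : Type*) [Field F] [Fintype F]
    (hF : Fintype.card F % 5 = 2 ∨ Fintype.card F % 5 = 3)
    (M : Matrix (Fin 3) (Fin 3) F) (hM : IsUnit M)
    (c : F) (hc : M ^ 5 = c • (1 : Matrix (Fin 3) (Fin 3) F)) :
    ∃ d : F, M = d • (1 : Matrix (Fin 3) (Fin 3) F) := by
  have hcdet : c ^ 3 = M.det ^ 5 := by
    simpa [Matrix.det_pow, Matrix.det_smul] using (congrArg Matrix.det hc).symm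
  have hdet : M.det ≠ 0 := ((Matrix.isUnit_iff_isUnit_det M).1 hM).ne_zero
  have hc0 : c ≠ 0 := by
    rintro rfl
    exact pow_ne_zero 5 hdet (by simpa using hcdet.symm)
  obtain ⟨e, he⟩ : ∃ e : F, e ^ 5 = c := by
    refine ⟨M.det ^ 2 / c, ?_⟩
    rw [div_pow, div_eq_iff (pow_ne_zero 5 hc0)]
    linear_combination (-(M.det ^ 5) - c ^ 3) * hcdet
  have he0 : e ≠ 0 := by
    rintro rfl
    exact hc0 (by simpa using he.symm)
  have hN : (e⁻¹ • M) ^ 5 = 1 := by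
    rw [smul_pow, hc, smul_smul, inv_pow, he, inv_mul_cancel₀ hc0, one_smul]
  let g : Matrix.GeneralLinearGroup (Fin 3) F := Units.ofPowEqOne (e⁻¹ • M) 5 hN (by norm_num)
  have hg : g ^ 5 = 1 := Units.ext hN
  have hg1 : g = 1 :=
    (powCoprime (coprime_natCard_GL_three_five F hF)).injective (by simpa using hg)
  have hM1 : e⁻¹ • M = 1 := congrArg Units.val hg1
  exact ⟨e, by rw [← hM1, smul_smul, mul_inv_cancel₀ he0, one_smul]⟩
end

section
/- Let F be a finite field whose cardinality is congruent to 2 or 3 modulo 5, and let M be a 5×5 matrix over F with M^5 = 1 and M ≠ 1. Then the characteristic polynomial of M equals X^5 − 1, and there exists an invertible 5×5 matrix P over F such that P⁻¹ * M * P is the permutation matrix of the 5-cycle sending i to i + 1 (mod 5) on Fin 5 (equivalently, the companion matrix of X^5 − 1). -/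
open Polynomial in
theorem FiniteField.irreducible_cyclotomic_five {F : Type*} [Field F] [Fintype F]
    (hF : Fintype.card F % 5 = 2 ∨ Fintype.card F % 5 = 3) :
    Irreducible (cyclotomic 5 F) := by
  obtain ⟨p, hp⟩ := CharP.exists F
  obtain ⟨f, hprime, hcard⟩ := FiniteField.card F p
  have : Fact p.Prime := ⟨hprime⟩
  have hcop : (p ^ (f : ℕ)).Coprime 5 := by
    rw [← hcard, Nat.coprime_comm, Nat.Prime.coprime_iff_not_dvd Nat.prime_five]
    lia
  have hcop' : p.Coprime 5 := (Nat.coprime_pow_left_iff f.pos _ _).mp hcop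
  refine irreducible_of_dvd_cyclotomic_of_natDegree (n := 5) (p := p) (f := f)
    hcard hcop' dvd_rfl ?_
  rw [natDegree_cyclotomic, Nat.totient_prime Nat.prime_five]
  have hval : ((p ^ (f : ℕ) : ℕ) : ZMod 5) = 2 ∨ ((p ^ (f : ℕ) : ℕ) : ZMod 5) = 3 := by
    rw [← hcard]
    exact hF.imp (fun h => (ZMod.natCast_eq_natCast_iff' _ 2 5).mpr h)
      (fun h => (ZMod.natCast_eq_natCast_iff' _ 3 5).mpr h)
  have : Fact (Nat.Prime 2) := ⟨Nat.prime_two⟩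
  refine (orderOf_eq_prime_pow (p := 2) (n := 1) ?_ ?_).symm <;>
  · rw [Units.ext_iff, Units.val_pow_eq_pow_val, ZMod.coe_unitOfCoprime]
    rcases hval with h | h <;> rw [h] <;> decide

theorem FiniteField.five_ne_zero {F : Type*} [Field F] [Fintype F]
    (hF : Fintype.card F % 5 = 2 ∨ Fintype.card F % 5 = 3) : (5 : F) ≠ 0 := by
  intro h5
  have hq := Nat.cast_card_eq_zero F
  rw [← Nat.div_add_mod (Fintype.card F) 5, Nat.cast_add, Nat.cast_mul] at hq
  apply one_ne_zero (α := F)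
  rcases hF with h | h <;> rw [h] at hq <;> push_cast at hq <;> rw [h5, zero_mul, zero_add] at hq
  · linear_combination h5 - 2 * hq
  · linear_combination 2 * hq - h5

open Matrix

/-- A linear map of order dividing `5` acts on the `#F ^ 5` vectors with a number of fixed points
congruent to `#F ^ 5` modulo `5`. -/
theorem Matrix.exists_ne_zero_mulVec_eq_self_of_pow_five_eq_one {F : Type*} [Field F] [Fintype F]
    (hF : Fintype.card F % 5 ≠ 1) {M : Matrix (Fin 5) (Fin 5) F} (h5 : M ^ 5 = 1) :
    ∃ u : Fin 5 → F, u ≠ 0 ∧ M *ᵥ u = u := by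
  classical
  have : Fact (Nat.Prime 5) := ⟨Nat.prime_five⟩
  by_contra! h
  let f : Function.End (Fin 5 → F) := M.mulVec
  have hpow (n : ℕ) : f ^ n = (M ^ n).mulVec := by
    induction n with
    | zero => rw [pow_zero, pow_zero]; exact funext fun x => (one_mulVec x).symm
    | succ n ih =>
      rw [pow_succ, ih, pow_succ]
      exact funext fun x => mulVec_mulVec x (M ^ n) M
  have hf : f ^ 5 ^ 1 = 1 := by
    rw [pow_one, hpow, h5]
    exact funext one_mulVec
  have hmod := Equiv.Perm.card_fixedPoints_modEq hf
  have hone : Fintype.card f.fixedPoints = 1 := by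
    rw [Fintype.card_eq_one_iff]
    refine ⟨⟨0, mulVec_zero M⟩, fun x => Subtype.ext ?_⟩
    by_contra hx
    exact h x hx x.2
  rw [hone, Fintype.card_fun, Fintype.card_fin, Nat.ModEq, Nat.pow_mod] at hmod
  have : Fintype.card F % 5 < 5 := Nat.mod_lt _ (by norm_num)
  interval_cases Fintype.card F % 5 <;> simp_all

open Polynomial in
theorem Matrix.aeval_mulVec_of_mulVec_eq_self {R n : Type*} [CommRing R] [Fintype n]
    [DecidableEq n] {M : Matrix n n R} {u : n → R} (hu : M *ᵥ u = u) (p : R[X]) :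
    aeval M p *ᵥ u = p.eval 1 • u := by
  induction p using Polynomial.induction_on with
  | C a => simp [Algebra.algebraMap_eq_smul_one, smul_mulVec]
  | add p q hp hq => rw [map_add, add_mulVec, hp, hq, eval_add, add_smul]
  | monomial k a ih =>
    rw [pow_succ, ← mul_assoc, map_mul, aeval_X, ← mulVec_mulVec, hu, ih]
    simp

open Polynomial in
/-- A non-identity matrix `M` with `M ^ 5 = 1` has a cyclic vector. -/
theorem Matrix.exists_cyclic_vector_of_pow_five_eq_one {F : Type*} [Field F] [Fintype F]
    (hF : Fintype.card F % 5 = 2 ∨ Fintype.card F % 5 = 3)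
    {M : Matrix (Fin 5) (Fin 5) F} (h5 : M ^ 5 = 1) (hne : M ≠ 1) :
    ∃ v : Fin 5 → F, ∀ p : F[X], p.degree < 5 → aeval M p *ᵥ v = 0 → p = 0 := by
  have : Fact (Nat.Prime 5) := ⟨Nat.prime_five⟩
  have hirr := FiniteField.irreducible_cyclotomic_five hF
  have h50 := FiniteField.five_ne_zero hF
  set Φ : F[X] := cyclotomic 5 F with hΦ
  have hΦ1 : Φ.eval 1 = 5 := by simp [hΦ, eval_one_cyclotomic_prime]
  have hkill : aeval M Φ * (M - 1) = 0 := by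
    have := congrArg (aeval M) (cyclotomic_prime_mul_X_sub_one F 5)
    simpa [h5] using this
  obtain ⟨u, hu0, hu⟩ := exists_ne_zero_mulVec_eq_self_of_pow_five_eq_one (by lia) h5
  obtain ⟨x, hx⟩ : ∃ x, (M - 1) *ᵥ x ≠ 0 := by
    by_contra! h
    exact hne (sub_eq_zero.mp (ext_of_mulVec_single fun i => by rw [h, zero_mulVec]))
  set w := (M - 1) *ᵥ x with hw
  have hΦw : aeval M Φ *ᵥ w = 0 := by rw [hw, mulVec_mulVec, hkill, zero_mulVec]
  have hsub (y : Fin 5 → F) : (M - 1) *ᵥ y = M *ᵥ y - y := by rw [sub_mulVec, one_mulVec]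
  have hMw : (M - 1) *ᵥ w ≠ 0 := by
    intro h
    rw [hsub, sub_eq_zero] at h
    rw [aeval_mulVec_of_mulVec_eq_self h, hΦ1] at hΦw
    exact smul_ne_zero h50 hx hΦw
  have hcomm (p : F[X]) : (M - 1) * aeval M p = aeval M p * (M - 1) := by
    have h : M - 1 = aeval M (X - 1 : F[X]) := by simp
    rw [h, ← map_mul, ← map_mul, mul_comm]
  refine ⟨u + w, fun p hp hpv => ?_⟩
  have hpw : aeval M p *ᵥ ((M - 1) *ᵥ w) = 0 := by
    have h := congrArg ((M - 1) *ᵥ ·) hpv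
    simp only [mulVec_zero] at h
    rw [mulVec_mulVec, hcomm, ← mulVec_mulVec, mulVec_add, hsub u, hu, sub_self, zero_add] at h
    exact h
  rcases dvd_or_isCoprime Φ p hirr with ⟨c, rfl⟩ | ⟨a, b, hab⟩
  · rw [mul_comm, map_mul, ← mulVec_mulVec, mulVec_add, hΦw, add_zero,
      aeval_mulVec_of_mulVec_eq_self hu, hΦ1] at hpv
    by_contra hc
    have hc0 : c ≠ 0 := right_ne_zero_of_mul hc
    rw [degree_eq_natDegree hc] at hp
    have hdeg : (Φ * c).natDegree < 5 := by exact_mod_cast hp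
    rw [natDegree_mul hirr.ne_zero hc0, hΦ, natDegree_cyclotomic,
      Nat.totient_prime Nat.prime_five] at hdeg
    rw [eq_C_of_natDegree_eq_zero (p := c) (by lia)] at hpv hc0
    rw [aeval_C, Algebra.algebraMap_eq_smul_one, smul_mulVec, one_mulVec] at hpv
    exact smul_ne_zero (by simpa using hc0) (smul_ne_zero h50 hu0) hpv
  · refine absurd ?_ hMw
    have h := congrArg (fun q => aeval M q *ᵥ ((M - 1) *ᵥ w)) hab
    simp only [map_add, map_mul, add_mulVec, ← mulVec_mulVec, hpw, map_one, one_mulVec] at h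
    rw [← h, mulVec_zero, add_zero, mulVec_mulVec w (aeval M Φ), hkill, zero_mulVec, mulVec_zero]

/-- Over a finite field `F` with `#F ≡ 2` or `3 (mod 5)`, a `5×5` matrix `M ≠ 1`
with `M⁵ = 1` has characteristic polynomial `X⁵ − 1` and is conjugate to the
permutation matrix of the `5`-cycle `i ↦ i + 1` on `Fin 5` (the companion
matrix of `X⁵ − 1`). -/
theorem stmt11 (F : Type*) [Field F] [Fintype F]
    (hF : Fintype.card F % 5 = 2 ∨ Fintype.card F % 5 = 3)
    (M : Matrix (Fin 5) (Fin 5) F) (h5 : M ^ 5 = 1) (hne : M ≠ 1) :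
    M.charpoly = Polynomial.X ^ 5 - 1 ∧
    ∃ P : Matrix (Fin 5) (Fin 5) F, IsUnit P ∧
      P⁻¹ * M * P = Matrix.of (fun i j : Fin 5 => if j = i + 1 then (1 : F) else 0) := by
  obtain ⟨v, hv⟩ := exists_cyclic_vector_of_pow_five_eq_one hF h5 hne
  refine ⟨?_, ?_⟩
  · rw [← sub_eq_zero]
    refine hv _ ?_ (by simp [aeval_self_charpoly, h5])
    have hdeg : M.charpoly.degree = (5 : ℕ) := by
      rw [charpoly_degree_eq_dim, Fintype.card_fin]
    have hdeg' : (Polynomial.X ^ 5 - 1 : Polynomial F).degree = (5 : ℕ) :=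
      Polynomial.degree_X_pow_sub_C (by norm_num) 1
    have h := Polynomial.degree_sub_lt_left (hdeg.trans hdeg'.symm) (charpoly_monic M).ne_zero
      ((charpoly_monic M).leadingCoeff.trans
        (Polynomial.leadingCoeff_X_pow_sub_C (by norm_num)).symm)
    rwa [hdeg] at h
  · let P : Matrix (Fin 5) (Fin 5) F := Matrix.of fun i j => (M ^ (j.rev : ℕ) *ᵥ v) i
    have hP : IsUnit P := by
      rw [← mulVec_injective_iff_isUnit]
      refine (injective_iff_map_eq_zero P.mulVecLin).mpr fun c hc => ?_
      let p : Polynomial F := ∑ j : Fin 5, Polynomial.monomial (j.rev : ℕ) (c j)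
      have hp0 : p = 0 := by
        refine hv p ?_ ?_
        · refine (Polynomial.degree_sum_le _ _).trans_lt ?_
          refine (Finset.sup_lt_iff (WithBot.bot_lt_coe _)).mpr fun j _ => ?_
          exact (Polynomial.degree_monomial_le _ _).trans_lt (by exact_mod_cast j.rev.2)
        · rw [← hc]
          simp only [p, map_sum, Polynomial.aeval_monomial, Algebra.algebraMap_eq_smul_one,
            smul_mul_assoc, one_mul, sum_mulVec, smul_mulVec]
          rw [mulVecLin_apply, mulVec_eq_sum]
          simp only [op_smul_eq_smul]
          rfl
      ext j
      have h := congrArg (fun q => q.coeff (j.rev : ℕ)) hp0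
      simpa only [p, Polynomial.coeff_zero, Polynomial.finsetSum_coeff, Polynomial.coeff_monomial,
        Fin.val_inj, Fin.rev_inj, Finset.sum_ite_eq', Finset.mem_univ, if_true, Pi.zero_apply] using h
    refine ⟨P, hP, ?_⟩
    have hMP : M * P = P * Matrix.of (fun i j : Fin 5 => if j = i + 1 then (1 : F) else 0) := by
      ext i j
      have hcol : (M * P) i j = (M ^ ((j.rev : ℕ) + 1) *ᵥ v) i := by
        rw [pow_succ', ← mulVec_mulVec]
        rfl
      rw [hcol, mul_apply]
      fin_cases j <;> simp [P, Fin.sum_univ_five, h5]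
    rw [mul_assoc, hMP, nonsing_inv_mul_cancel_left _ _ ((isUnit_iff_isUnit_det P).mp hP)]
end

section
/- Let K be a field and let ζ ∈ K be an element of multiplicative order 5 (a primitive fifth root of unity). Let p = (1, ζ, ζ², ζ³, ζ⁴) ∈ K⁵. Then P₁(p) = P₂(p) = P₃(p) = 0, and the gradient vectors satisfy ∇P₁(p) = 2 • p, ∇P₂(p) = (ζ + ζ⁴) • p, ∇P₃(p) = (ζ² + ζ³) • p. In particular all three gradients are scalar multiples of p, so the Jacobian matrix of (P₁, P₂, P₃) at p has rank at most 1, and p is a singular point of the variety defined by any three quadrics in the span of P₁, P₂, P₃. -/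
open MvPolynomial

/-- Let `ζ ∈ K` have multiplicative order `5` and `p = (1, ζ, ζ², ζ³, ζ⁴)`.
For `P₁ = ∑ xᵢ²`, `P₂ = ∑ xᵢ x_{i+1}`, `P₃ = ∑ xᵢ x_{i+2}` one has
`P₁(p) = P₂(p) = P₃(p) = 0`, the gradients satisfy `∇P₁(p) = 2 • p`,
`∇P₂(p) = (ζ + ζ⁴) • p`, `∇P₃(p) = (ζ² + ζ³) • p`, and the Jacobian matrix of
`(P₁, P₂, P₃)` at `p` has rank at most `1` (so `p` is a singular point of the
variety cut out by any three quadrics in the span of `P₁, P₂, P₃`). -/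
theorem stmt13 (K : Type*) [Field K] (ζ : K) (hζ : orderOf ζ = 5)
    (P₁ P₂ P₃ : MvPolynomial (Fin 5) K)
    (hP₁ : P₁ = X 0 ^ 2 + X 1 ^ 2 + X 2 ^ 2 + X 3 ^ 2 + X 4 ^ 2)
    (hP₂ : P₂ = X 0 * X 1 + X 1 * X 2 + X 2 * X 3 + X 3 * X 4 + X 4 * X 0)
    (hP₃ : P₃ = X 0 * X 2 + X 1 * X 3 + X 2 * X 4 + X 3 * X 0 + X 4 * X 1)
    (p : Fin 5 → K) (hp : p = fun i : Fin 5 => ζ ^ (i : ℕ)) :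
    eval p P₁ = 0 ∧ eval p P₂ = 0 ∧ eval p P₃ = 0 ∧
    (fun i => eval p (pderiv i P₁)) = (2 : K) • p ∧
    (fun i => eval p (pderiv i P₂)) = (ζ + ζ ^ 4) • p ∧
    (fun i => eval p (pderiv i P₃)) = (ζ ^ 2 + ζ ^ 3) • p ∧
    (Matrix.of fun (k : Fin 3) (i : Fin 5) =>
        eval p (pderiv i (![P₁, P₂, P₃] k))).rank ≤ 1 := by
  have h5 : ζ ^ 5 = 1 := hζ ▸ pow_orderOf_eq_one ζ
  have hne : ζ ≠ 1 := by
    rintro rfl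
    simp at hζ
  have hsum : 1 + ζ + ζ ^ 2 + ζ ^ 3 + ζ ^ 4 = 0 := by
    apply mul_left_cancel₀ (sub_ne_zero.mpr hne)
    linear_combination h5
  have hgrad₁ : (fun i => eval p (pderiv i P₁)) = (2 : K) • p := by
    subst hP₁ hp
    funext i
    fin_cases i <;> simp [pderiv_X]
  have hgrad₂ : (fun i => eval p (pderiv i P₂)) = (ζ + ζ ^ 4) • p := by
    subst hP₂ hp
    funext i
    fin_cases i <;> simp [pderiv_X] <;> grind
  have hgrad₃ : (fun i => eval p (pderiv i P₃)) = (ζ ^ 2 + ζ ^ 3) • p := by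
    subst hP₃ hp
    funext i
    fin_cases i <;> simp [pderiv_X] <;> grind
  refine ⟨?_, ?_, ?_, hgrad₁, hgrad₂, hgrad₃, ?_⟩
  · subst hP₁ hp
    simp
    grind
  · subst hP₂ hp
    simp
    grind
  · subst hP₃ hp
    simp
    grind
  · have hJ : (Matrix.of fun (k : Fin 3) (i : Fin 5) =>
        eval p (pderiv i (![P₁, P₂, P₃] k))) =
        Matrix.vecMulVec ![2, ζ + ζ ^ 4, ζ ^ 2 + ζ ^ 3] p := by
      ext k i
      fin_cases k
      · exact congrFun hgrad₁ i
      · exact congrFun hgrad₂ i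
      · exact congrFun hgrad₃ i
    rw [hJ]
    exact Matrix.rank_vecMulVec_le _ _
end

section
/- Let K be a field and ζ ∈ K an element of multiplicative order 5. Let F ∈ K[X, Y, Z] be a homogeneous polynomial of degree 5 satisfying F(X, ζ·Y, ζ⁴·Z) = F(X, Y, Z). Then there exist a₀, a₁, a₂, a₃, a₄ ∈ K such that F = a₀·X⁵ + a₁·Y⁵ + a₂·Z⁵ + a₃·X·Y²·Z² + a₄·X³·Y·Z. -/
open MvPolynomial

/-- Rescaling each variable `X i` by `c i` multiplies the coefficient at `d` by `∏ c i ^ d i`. -/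
theorem MvPolynomial.coeff_aeval_C_mul_X {σ R : Type*} [CommSemiring R] (c : σ → R)
    (F : MvPolynomial σ R) (d : σ →₀ ℕ) :
    coeff d (aeval (fun i => C (c i) * X i) F : MvPolynomial σ R) =
      d.prod (fun i n => c i ^ n) * coeff d F := by
  classical
  induction F using MvPolynomial.induction_on' with
  | monomial e a =>
    have h : (aeval (fun i => C (c i) * X i) (monomial e a) : MvPolynomial σ R) =
        monomial e (e.prod (fun i n => c i ^ n) * a) := by
      rw [aeval_monomial, monomial_eq (s := e), algebraMap_eq]
      simp only [mul_pow, Finset.prod_mul_distrib, map_mul, Finsupp.prod, map_prod, map_pow]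
      ring
    rw [h, coeff_monomial, coeff_monomial]
    split_ifs with hed
    · rw [hed]
    · rw [mul_zero]
  | add p q hp hq => rw [map_add, coeff_add, coeff_add, hp, hq, mul_add]

/-- A monomial in three variables, with its exponents written out. -/
theorem MvPolynomial.monomial_fin_three {R : Type*} [CommSemiring R] (i j k : ℕ) (a : R) :
    monomial (Finsupp.equivFunOnFinite.symm ![i, j, k]) a =
      C a * (X 0 ^ i * X 1 ^ j * X 2 ^ k) := by
  rw [monomial_eq, Finsupp.prod_fintype _ _ (fun i => pow_zero _), Fin.prod_univ_three]
  simp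

/-- Let `ζ ∈ K` have multiplicative order `5`. A quintic homogeneous
`F ∈ K[X,Y,Z]` with `F(X, ζY, ζ⁴Z) = F(X, Y, Z)` lies in the span of
`X⁵, Y⁵, Z⁵, XY²Z², X³YZ`. -/
theorem stmt14 (K : Type*) [Field K] (ζ : K) (hζ : orderOf ζ = 5)
    (F : MvPolynomial (Fin 3) K) (hhom : F.IsHomogeneous 5)
    (hinv : aeval ![(X 0 : MvPolynomial (Fin 3) K), C ζ * X 1, C (ζ ^ 4) * X 2] F = F) :
    ∃ a₀ a₁ a₂ a₃ a₄ : K,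
      F = C a₀ * X 0 ^ 5 + C a₁ * X 1 ^ 5 + C a₂ * X 2 ^ 5
        + C a₃ * (X 0 * X 1 ^ 2 * X 2 ^ 2) + C a₄ * (X 0 ^ 3 * X 1 * X 2) := by
  have hsubst : ![(X 0 : MvPolynomial (Fin 3) K), C ζ * X 1, C (ζ ^ 4) * X 2] =
      fun i => C (![1, ζ, ζ ^ 4] i) * X i := by
    ext1 i
    fin_cases i <;> simp
  rw [hsubst] at hinv
  let m (i j k : ℕ) : Fin 3 →₀ ℕ := Finsupp.equivFunOnFinite.symm ![i, j, k]
  let S : Finset (Fin 3 →₀ ℕ) := {m 5 0 0, m 0 5 0, m 0 0 5, m 1 2 2, m 3 1 1}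
  have hsupp : F.support ⊆ S := by
    intro d hd
    have hne := mem_support_iff.mp hd
    have hdeg : d 0 + d 1 + d 2 = 5 := by
      have h := hhom.coeff_eq_zero (d := d)
      rw [Finsupp.degree_eq_sum, Fin.sum_univ_three] at h
      exact of_not_not (mt h hne)
    have hdvd : 5 ∣ d 1 + 4 * d 2 := by
      have h := coeff_aeval_C_mul_X ![1, ζ, ζ ^ 4] F d
      rw [hinv, eq_comm, mul_eq_right₀ hne, Finsupp.prod_fintype _ _ (fun i => pow_zero _),
        Fin.prod_univ_three] at h
      rw [← hζ]
      apply orderOf_dvd_of_pow_eq_one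
      simpa [pow_add, pow_mul] using h
    have hd_eq : d = m (d 0) (d 1) (d 2) := by
      ext i
      fin_cases i <;> rfl
    have hcases : (d 0 = 5 ∧ d 1 = 0 ∧ d 2 = 0) ∨ (d 0 = 0 ∧ d 1 = 5 ∧ d 2 = 0) ∨
        (d 0 = 0 ∧ d 1 = 0 ∧ d 2 = 5) ∨ (d 0 = 1 ∧ d 1 = 2 ∧ d 2 = 2) ∨
        (d 0 = 3 ∧ d 1 = 1 ∧ d 2 = 1) := by
      have h2 : d 2 ≤ 5 := by omega
      interval_cases d 2 <;> omega
    rw [hd_eq]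
    rcases hcases with ⟨h0, h1, h2⟩ | ⟨h0, h1, h2⟩ | ⟨h0, h1, h2⟩ | ⟨h0, h1, h2⟩ | ⟨h0, h1, h2⟩ <;>
      simp [S, h0, h1, h2]
  have hF : F = ∑ d ∈ S, monomial d (coeff d F) := by
    conv_lhs => rw [F.as_sum]
    exact Finset.sum_subset hsupp fun d _ hd => by simp [notMem_support_iff.mp hd]
  refine ⟨coeff (m 5 0 0) F, coeff (m 0 5 0) F, coeff (m 0 0 5) F, coeff (m 1 2 2) F,
    coeff (m 3 1 1) F, ?_⟩
  conv_lhs => rw [hF]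
  simp only [S]
  rw [Finset.sum_insert (by simp [m]), Finset.sum_insert (by simp [m]),
    Finset.sum_insert (by simp [m]), Finset.sum_insert (by simp [m]), Finset.sum_singleton]
  simp only [m, monomial_fin_three]
  ring
end

section
/- Let A = ℤ[γ] = ℤ[X]/(X² − X + 5), where γ denotes the class of X (so γ² = γ − 5). Define the 5×5 matrices over A: R with rows (−γ−1, 3γ−7, −2γ, 4, 0), (γ+1, 2γ+1, −2, 0, 4), (γ−2, 4γ−8, −2γ−1, 2, 2γ+2), (−γ+4, −γ−6, −γ+4, 2γ+1, −γ+2), (0, 6, γ−2, −γ, −γ); and S with rows (−1, −γ−1, 2, 0, 0), (0, 1, 0, 0, 0), (0, 0, 1, 0, 0), (0, −γ+3, γ, 0, 1), (0, γ−3, −γ, 1, 0). Then R⁵ = 1, S² = 1, R ≠ 1, S ≠ 1, and R·S·R = S; consequently R and S generate a subgroup of GL₅(A) isomorphic to the dihedral group of order 10. -/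
open Polynomial

namespace DihedralGroup

variable {M : Type*} [Monoid M] {n : ℕ}

lemma pow_val_add [NeZero n] {a : M} (ha : a ^ n = 1) (i j : ZMod n) :
    a ^ (i + j).val = a ^ i.val * a ^ j.val := by
  rw [ZMod.val_add, ← pow_add, ← pow_eq_pow_mod _ ha]

lemma pow_mul_mul_pow {a b : M} (hab : a * b * a = b) (k : ℕ) : a ^ k * b * a ^ k = b := by
  induction k with
  | zero => simp
  | succ k ih =>
    calc a ^ (k + 1) * b * a ^ (k + 1) = a ^ k * (a * b * a) * a ^ k := by
          rw [pow_succ a k]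
          nth_rewrite 2 [← pow_succ a k]
          rw [pow_succ' a k]
          simp only [mul_assoc]
      _ = b := by rw [hab, ih]

lemma pow_val_mul [NeZero n] {a b : M} (ha : a ^ n = 1) (hab : a * b * a = b) (i j : ZMod n) :
    a ^ i.val * (b * a ^ j.val) = b * a ^ (j - i).val := by
  have h : a ^ j.val = a ^ i.val * a ^ (j - i).val := by
    rw [← pow_val_add ha, add_sub_cancel]
  rw [h, ← mul_assoc, ← mul_assoc, pow_mul_mul_pow hab]

/-- The homomorphism out of a finite dihedral group given by elements satisfying its defining
relations. -/
def liftOfRel [NeZero n] (a b : M) (ha : a ^ n = 1) (hb : b ^ 2 = 1) (hab : a * b * a = b) :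
    DihedralGroup n →* M where
  toFun
    | r i => a ^ i.val
    | sr i => b * a ^ i.val
  map_one' := by rw [one_def]; simp only [ZMod.val_zero, pow_zero]
  map_mul' x y := by
    rcases x with i | i <;> rcases y with j | j
    · simp only [r_mul_r, pow_val_add ha]
    · simp only [r_mul_sr, pow_val_mul ha hab]
    · simp only [sr_mul_r, pow_val_add ha, mul_assoc]
    · simp only [sr_mul_sr]
      rw [mul_assoc, pow_val_mul ha hab, ← mul_assoc, ← sq, hb, one_mul]

lemma liftOfRel_r [NeZero n] {a b : M} (ha : a ^ n = 1) (hb : b ^ 2 = 1) (hab : a * b * a = b)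
    (i : ZMod n) : liftOfRel a b ha hb hab (r i) = a ^ i.val := rfl

lemma liftOfRel_sr [NeZero n] {a b : M} (ha : a ^ n = 1) (hb : b ^ 2 = 1) (hab : a * b * a = b)
    (i : ZMod n) : liftOfRel a b ha hb hab (sr i) = b * a ^ i.val := rfl

lemma liftOfRel_injective {p : ℕ} [hp : Fact p.Prime] (hp2 : p ≠ 2) {a b : M} (ha : a ^ p = 1)
    (hb : b ^ 2 = 1) (hab : a * b * a = b) (ha1 : a ≠ 1) :
    Function.Injective (liftOfRel a b ha hb hab) := by
  have ho : orderOf a = p := orderOf_eq_prime ha ha1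
  rw [injective_iff_map_eq_one]
  rintro (i | i) h
  · rw [liftOfRel_r, ← orderOf_dvd_iff_pow_eq_one, ho] at h
    have hi : i.val = 0 := Nat.eq_zero_of_dvd_of_lt h (ZMod.val_lt i)
    rw [(ZMod.val_eq_zero i).1 hi, r_zero]
  · rw [liftOfRel_sr] at h
    have hbi : a ^ i.val = b := by
      calc a ^ i.val = b * (b * a ^ i.val) := by rw [← mul_assoc, ← sq, hb, one_mul]
        _ = b := by rw [h, mul_one]
    have hcomm : a * b = b * a := by rw [← hbi, ← pow_succ, ← pow_succ']
    have hsq : a ^ 2 = 1 := by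
      calc a ^ 2 = b * (b * a) * a := by rw [← mul_assoc, ← sq b, hb, one_mul, sq]
        _ = 1 := by rw [← hcomm, mul_assoc, hab, ← sq, hb]
    have hdvd : p ∣ 2 := ho ▸ orderOf_dvd_of_pow_eq_one hsq
    exact absurd ((Nat.prime_dvd_prime_iff_eq hp.out Nat.prime_two).1 hdvd) hp2

end DihedralGroup

section Matrices

variable {A : Type*} [CommRing A]

/-- An order-`5` matrix over a ring with a chosen element `γ` satisfying `γ² = γ - 5`. -/
def rotationMatrix (γ : A) : Matrix (Fin 5) (Fin 5) A :=
  !![-γ - 1, 3 * γ - 7, -2 * γ, 4, 0;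
     γ + 1, 2 * γ + 1, -2, 0, 4;
     γ - 2, 4 * γ - 8, -2 * γ - 1, 2, 2 * γ + 2;
     -γ + 4, -γ - 6, -γ + 4, 2 * γ + 1, -γ + 2;
     0, 6, γ - 2, -γ, -γ]

/-- An involution inverting `rotationMatrix γ` by conjugation when `γ² = γ - 5`. -/
def reflectionMatrix (γ : A) : Matrix (Fin 5) (Fin 5) A :=
  !![-1, -γ - 1, 2, 0, 0;
     0, 1, 0, 0, 0;
     0, 0, 1, 0, 0;
     0, -γ + 3, γ, 0, 1;
     0, γ - 3, -γ, 1, 0]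

set_option maxHeartbeats 1000000 in
lemma rotationMatrix_sq {γ : A} (hγ : γ ^ 2 = γ - 5) :
    rotationMatrix γ ^ 2 =
      !![0, 1, 0, 0, 0;
         -1, -γ - 1, 2, 0, 0;
         -γ - 1, -1, 1, 2, 0;
         1, -5, -γ + 3, γ, 1;
         0, γ - 3, -γ, 1, 0] := by
  rw [sq, rotationMatrix]
  ext i j
  fin_cases i <;> fin_cases j <;> simp [Matrix.mul_apply, Fin.sum_univ_five] <;> grind

set_option maxHeartbeats 1000000 in
lemma rotationMatrix_pow_three {γ : A} (hγ : γ ^ 2 = γ - 5) :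
    rotationMatrix γ ^ 3 =
      !![γ + 1, 2 * γ + 1, -2, 0, 4;
         1, 0, 0, 0, 0;
         γ + 1, γ + 1, -1, 0, 2;
         γ - 2, 2 * γ - 5, -γ, 0, 2 * γ + 1;
         -γ + 1, 1, 0, 1, -γ] := by
  rw [pow_succ, rotationMatrix_sq hγ, rotationMatrix]
  ext i j
  fin_cases i <;> fin_cases j <;> simp [Matrix.mul_apply, Fin.sum_univ_five] <;> grind

set_option maxHeartbeats 1000000 in
lemma rotationMatrix_pow_five {γ : A} (hγ : γ ^ 2 = γ - 5) :
    rotationMatrix γ ^ 5 = 1 := by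
  rw [show rotationMatrix γ ^ 5 = rotationMatrix γ ^ 2 * rotationMatrix γ ^ 3 from pow_add _ 2 3,
    rotationMatrix_sq hγ, rotationMatrix_pow_three hγ]
  ext i j
  fin_cases i <;> fin_cases j <;> simp [Matrix.mul_apply, Fin.sum_univ_five] <;> grind

lemma reflectionMatrix_sq (γ : A) :
    reflectionMatrix γ ^ 2 = 1 := by
  rw [sq, reflectionMatrix]
  ext i j
  fin_cases i <;> fin_cases j <;> simp [Matrix.mul_apply, Fin.sum_univ_five]
  ring

set_option maxHeartbeats 1000000 in
lemma rotationMatrix_mul_reflectionMatrix {γ : A} (hγ : γ ^ 2 = γ - 5) :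
    rotationMatrix γ * reflectionMatrix γ =
      !![γ + 1, 2 * γ + 1, -2, 0, 4;
         -γ - 1, 3 * γ - 7, -2 * γ, 4, 0;
         -γ + 2, -11, -2 * γ + 5, 2 * γ + 2, 2;
         γ - 4, 4 * γ - 3, -γ - 3, -γ + 2, 2 * γ + 1;
         0, 6, γ - 2, -γ, -γ] := by
  rw [rotationMatrix, reflectionMatrix]
  ext i j
  fin_cases i <;> fin_cases j <;> simp [Matrix.mul_apply, Fin.sum_univ_five] <;> grind

set_option maxHeartbeats 1000000 in
lemma rotationMatrix_mul_reflectionMatrix_mul_rotationMatrix {γ : A} (hγ : γ ^ 2 = γ - 5) :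
    rotationMatrix γ * reflectionMatrix γ * rotationMatrix γ = reflectionMatrix γ := by
  rw [rotationMatrix_mul_reflectionMatrix hγ, rotationMatrix, reflectionMatrix]
  ext i j
  fin_cases i <;> fin_cases j <;> simp [Matrix.mul_apply, Fin.sum_univ_five] <;> grind

end Matrices

/-- In `A = ℤ[γ] = ℤ[X]/(X² − X + 5)` the explicit matrices `R` and `S`
satisfy `R⁵ = 1`, `S² = 1`, `R ≠ 1`, `S ≠ 1`, `R·S·R = S`, and they generate a
subgroup of `GL₅(A)` isomorphic to the dihedral group of order `10` (witnessed
by an injective monoid homomorphism `DihedralGroup 5 →* Mat₅(A)` sending the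
generators `r` and `s` to `R` and `S`). -/
theorem stmt17 (A : Type) (γ : A) [CommRing A]
    (e : (AdjoinRoot (Polynomial.X ^ 2 - Polynomial.X + 5 : Polynomial ℤ)) ≃+* A)
    (hγ : e (AdjoinRoot.root _) = γ)
    (R S : Matrix (Fin 5) (Fin 5) A)
    (hR : R = !![-γ - 1, 3 * γ - 7, -2 * γ, 4, 0;
                 γ + 1, 2 * γ + 1, -2, 0, 4;
                 γ - 2, 4 * γ - 8, -2 * γ - 1, 2, 2 * γ + 2;
                 -γ + 4, -γ - 6, -γ + 4, 2 * γ + 1, -γ + 2;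
                 0, 6, γ - 2, -γ, -γ])
    (hS : S = !![-1, -γ - 1, 2, 0, 0;
                 0, 1, 0, 0, 0;
                 0, 0, 1, 0, 0;
                 0, -γ + 3, γ, 0, 1;
                 0, γ - 3, -γ, 1, 0]) :
    R ^ 5 = 1 ∧ S ^ 2 = 1 ∧ R ≠ 1 ∧ S ≠ 1 ∧ R * S * R = S ∧
    ∃ φ : DihedralGroup 5 →* Matrix (Fin 5) (Fin 5) A,
      Function.Injective φ ∧ φ (DihedralGroup.r 1) = R ∧ φ (DihedralGroup.sr 0) = S := by
  have hrel : γ ^ 2 = γ - 5 := by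
    have h := AdjoinRoot.eval₂_root (X ^ 2 - X + 5 : ℤ[X])
    simp only [eval₂_add, eval₂_sub, eval₂_pow, eval₂_X, eval₂_ofNat] at h
    have h' := congrArg e h
    simp only [map_add, map_sub, map_pow, hγ, map_zero, map_ofNat] at h'
    linear_combination h'
  have hnt : Nontrivial A := by
    let f : AdjoinRoot (X ^ 2 - X + 5 : ℤ[X]) →+* ZMod 5 :=
      AdjoinRoot.lift (Int.castRingHom (ZMod 5)) 0 (by
        simp only [eval₂_add, eval₂_sub, eval₂_pow, eval₂_X, eval₂_ofNat]
        decide)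
    have : Fact (1 < 5) := ⟨by decide⟩
    exact (f.comp e.symm.toRingHom).domain_nontrivial
  have hne (h0 : γ = 0) (h2 : (2 : A) = 0) : False := by
    apply one_ne_zero (α := A)
    linear_combination hrel - (γ - 1) * h0 - 2 * h2
  have hR5 : R ^ 5 = 1 := hR ▸ rotationMatrix_pow_five hrel
  have hS2 : S ^ 2 = 1 := hS ▸ reflectionMatrix_sq γ
  have hRSR : R * S * R = S :=
    hR ▸ hS ▸ rotationMatrix_mul_reflectionMatrix_mul_rotationMatrix hrel
  have hR1 : R ≠ 1 := by
    intro h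
    have h42 : γ - 2 = 0 := by simpa [hR] using congrFun₂ h 4 2
    have h43 : γ = 0 := by simpa [hR] using congrFun₂ h 4 3
    exact hne h43 (by linear_combination h43 - h42)
  have hS1 : S ≠ 1 := by
    intro h
    have h00 : (-1 : A) = 1 := by simpa [hS] using congrFun₂ h 0 0
    have h32 : γ = 0 := by simpa [hS] using congrFun₂ h 3 2
    exact hne h32 (by linear_combination -h00)
  have : Fact (Nat.Prime 5) := ⟨Nat.prime_five⟩
  refine ⟨hR5, hS2, hR1, hS1, hRSR, DihedralGroup.liftOfRel R S hR5 hS2 hRSR,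
    DihedralGroup.liftOfRel_injective (by decide) hR5 hS2 hRSR hR1, ?_, ?_⟩
  · rw [DihedralGroup.liftOfRel_r, ZMod.val_one, pow_one]
  · rw [DihedralGroup.liftOfRel_sr, ZMod.val_zero, pow_zero, mul_one]
end
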